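/- arXiv:1803.00666 — 2 statements merged into one kernel-verified Lean document; each statement's English description precedes it below -/
import Mathlib

section
/- Let Gt = (V, E, {f_v}) be a general threshold instance whose underlying graph is a layered graph with layers V_1, …, V_m, and suppose f_v is AD-k for every v ∈ V. Then for every node v ∈ V, the set function S_m ↦ P_v(S_m) on subsets S_m of the bottom layer V_m (the probability that v is active at the end of a diffusion started from seed set S_m ⊆ V_m) is AD-k as a set function on 2^{V_m}. -/
open MeasureTheory Finset
open scoped Classical

noncomputable section


/-- The difference of a set function `f` over a set `A`, evaluated at `S`:
`Δ_A f(S) = ∑_{B ⊆ A} (-1)^{|B|} f(S ∪ (A \ B))`. -/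
def adDiff {V : Type*} [DecidableEq V] (f : Finset V → ℝ) (A S : Finset V) : ℝ :=
  ∑ B ∈ A.powerset, (-1 : ℝ) ^ B.card * f (S ∪ (A \ B))

/-- A set function `f : 2^V → ℝ` is AD-`k` if `(-1)^{|A|+1} Δ_A f(S) ≥ 0` for every
nonempty `A` with `|A| ≤ k` and every `S`. -/
def IsADk {V : Type*} [DecidableEq V] (f : Finset V → ℝ) (k : ℕ) : Prop :=
  ∀ A S : Finset V, A.Nonempty → A.card ≤ k →
    0 ≤ (-1 : ℝ) ^ (A.card + 1) * adDiff f A S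



/-- A general threshold instance on a finite directed graph `(V, E)`:
each node `v` has a threshold function `f v : 2^V → [0,1]` that is monotone,
vanishes on `∅`, and depends only on the in-neighbors of `v`. -/
structure GTInstance (V : Type*) [Fintype V] [DecidableEq V] where
  E : V → V → Prop
  f : V → Finset V → ℝ
  f_nonneg : ∀ v S, 0 ≤ f v S
  f_le_one : ∀ v S, f v S ≤ 1
  f_mono : ∀ v, Monotone (f v)
  f_empty : ∀ v, f v ∅ = 0
  f_local : ∀ v S, f v S = f v (S.filter fun u => E u v)

variable {V : Type*} [Fintype V] [DecidableEq V]

/-- The deterministic cascade for threshold vector `θ` and seed set `S`: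
`C_0 = S`, `C_{t+1} = C_t ∪ {v : f_v(C_t) ≥ θ_v}`. -/
def cascade (gt : GTInstance V) (θ : V → ℝ) (S : Finset V) : ℕ → Finset V
  | 0 => S
  | t + 1 =>
      cascade gt θ S t ∪ Finset.univ.filter fun v => θ v ≤ gt.f v (cascade gt θ S t)

/-- The final active set of the cascade. -/
def finalSet (gt : GTInstance V) (θ : V → ℝ) (S : Finset V) : Finset V :=
  cascade gt θ S (Fintype.card V)

/-- The uniform (Lebesgue product) probability measure on `[0,1]^V`. -/
def cubeMeasure (V : Type*) [Fintype V] : Measure (V → ℝ) :=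
  Measure.pi fun _ => volume.restrict (Set.Icc 0 1)

/-- `activationProb gt v S` is the probability (over uniform thresholds) that `v`
is active at the end of the diffusion started from seed set `S`. -/
def activationProb (gt : GTInstance V) (v : V) (S : Finset V) : ℝ :=
  (cubeMeasure V {θ | v ∈ finalSet gt θ S}).toReal

/-- The spread function `σ(S) = ∑_{v ∈ V} P_v(S)`. -/
def spread (gt : GTInstance V) (S : Finset V) : ℝ :=
  ∑ v : V, activationProb gt v S

/-- The underlying graph is a layered graph with `m ≥ 2` layers (layer indices `1, …, m`),
all edges going from a node of layer `i+1` to a node of layer `i`. -/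
def IsLayered (gt : GTInstance V) (m : ℕ) (layer : V → ℕ) : Prop :=
  2 ≤ m ∧ (∀ v, 1 ≤ layer v ∧ layer v ≤ m) ∧
    ∀ u v, gt.E u v → layer u = layer v + 1

/-- The underlying graph is a directed acyclic graph (no directed cycles). -/
def IsDAG (gt : GTInstance V) : Prop := ∀ v, ¬ Relation.TransGen gt.E v v


/-- A set function on subsets of `W` is AD-`k` relative to the ground set `W`. -/
def IsADkOn {V : Type*} [DecidableEq V] (W : Finset V) (f : Finset V → ℝ) (k : ℕ) : Prop :=
  ∀ A S : Finset V, A ⊆ W → S ⊆ W → A.Nonempty → A.card ≤ k →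
    0 ≤ (-1 : ℝ) ^ (A.card + 1) * adDiff f A S

section ADHelpers

lemma adDiff_insert {V : Type*} [DecidableEq V] (f : Finset V → ℝ) (a : V) (A S : Finset V)
    (ha : a ∉ A) : adDiff f (insert a A) S = adDiff f A (insert a S) - adDiff f A S := by
  unfold adDiff
  rw [Finset.sum_powerset_insert ha, sub_eq_add_neg, ← Finset.sum_neg_distrib]
  congr 1
  · refine Finset.sum_congr rfl fun B hB => ?_
    have hBA := Finset.mem_powerset.mp hB
    have : S ∪ (insert a A \ B) = insert a S ∪ (A \ B) := by
      ext x
      simp only [Finset.mem_union, Finset.mem_sdiff, Finset.mem_insert]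
      by_cases hx : x = a
      · subst hx
        have : x ∉ B := fun h => ha (hBA h)
        simp [this]
      · simp [hx]
    rw [this]
  · refine Finset.sum_congr rfl fun B hB => ?_
    have hBA := Finset.mem_powerset.mp hB
    have haB : a ∉ B := fun h => ha (hBA h)
    have : S ∪ (insert a A \ insert a B) = S ∪ (A \ B) := by
      ext x
      simp only [Finset.mem_union, Finset.mem_sdiff, Finset.mem_insert]
      by_cases hx : x = a
      · subst hx; simp [ha]
      · simp [hx]
    rw [this, Finset.card_insert_of_notMem haB, pow_succ]
    ring

lemma adDiff_empty {V : Type*} [DecidableEq V] (f : Finset V → ℝ) (S : Finset V) :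
    adDiff f ∅ S = f S := by
  simp [adDiff]

lemma adDiff_eq_zero {V : Type*} [DecidableEq V] (f : Finset V → ℝ) (a : V) (A S : Finset V)
    (ha : a ∈ A) (hS : a ∈ S) : adDiff f A S = 0 := by
  rw [← Finset.insert_erase ha, adDiff_insert _ _ _ _ (Finset.notMem_erase a A),
    Finset.insert_eq_of_mem hS, sub_self]

lemma adDiff_mul {V : Type*} [DecidableEq V] (f h : Finset V → ℝ) (A : Finset V) :
    ∀ S, adDiff (fun T => f T * h T) A S
      = ∑ B ∈ A.powerset, adDiff f B S * adDiff h (A \ B) (S ∪ B) := by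
  induction A using Finset.induction_on with
  | empty => intro S; simp [adDiff_empty]
  | insert a A ha ih =>
    intro S
    rw [adDiff_insert _ _ _ _ ha, ih, ih, Finset.sum_powerset_insert ha,
      ← Finset.sum_sub_distrib, ← Finset.sum_add_distrib]
    refine Finset.sum_congr rfl fun B hB => ?_
    have hBA := Finset.mem_powerset.mp hB
    have haB : a ∉ B := fun h => ha (hBA h)
    have h1 : insert a A \ B = insert a (A \ B) := Finset.insert_sdiff_of_notMem _ haB
    have h2 : insert a A \ insert a B = A \ B := by
      ext x
      simp only [Finset.mem_sdiff, Finset.mem_insert]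
      by_cases hx : x = a
      · subst hx; simp [ha]
      · simp [hx]
    have h3 : a ∉ A \ B := by simp [ha]
    rw [h1, h2, adDiff_insert _ _ _ _ h3, adDiff_insert _ _ _ _ haB,
      Finset.insert_union, Finset.union_insert]
    ring

lemma adDiff_shift {V : Type*} [DecidableEq V] (F : Finset V → ℝ) (u : V) (A S : Finset V) :
    adDiff (fun T => F (insert u T) - F T) A S = adDiff F A (insert u S) - adDiff F A S := by
  unfold adDiff
  rw [← Finset.sum_sub_distrib]
  refine Finset.sum_congr rfl fun B _ => ?_
  rw [Finset.insert_union]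
  ring

lemma adDiff_add {V : Type*} [DecidableEq V] (F H : Finset V → ℝ) (A S : Finset V) :
    adDiff (fun T => F T + H T) A S = adDiff F A S + adDiff H A S := by
  unfold adDiff
  rw [← Finset.sum_add_distrib]
  exact Finset.sum_congr rfl fun B _ => by ring

/-- Replacing a node by an AD-`k` random activation preserves AD-`k`. -/
lemma IsADk.compose {V : Type*} [DecidableEq V] {F f : Finset V → ℝ} {k : ℕ} (u : V)
    (hF : IsADk F k) (hf : IsADk f k) (h0 : ∀ S, 0 ≤ f S) (h1 : ∀ S, f S ≤ 1) :
    IsADk (fun S => F S + f S * (F (insert u S) - F S)) k := by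
  have hh : ∀ C T : Finset V, C.card + 1 ≤ k →
      0 ≤ (-1 : ℝ) ^ C.card * adDiff (fun T => F (insert u T) - F T) C T := by
    intro C T hC
    rw [adDiff_shift]
    by_cases hu : u ∈ C
    · rw [adDiff_eq_zero F u C _ hu (Finset.mem_insert_self _ _)]
      have := hF C T ⟨u, hu⟩ (by omega)
      rw [pow_succ] at this
      linarith
    · rw [← adDiff_insert _ _ _ _ hu]
      have := hF (insert u C) T ⟨u, by simp⟩ (by rw [Finset.card_insert_of_notMem hu]; exact hC)
      rw [Finset.card_insert_of_notMem hu, pow_succ, pow_succ] at this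
      linarith
  intro A S hA hk
  rw [adDiff_add, adDiff_mul f (fun S => F (insert u S) - F S),
    ← Finset.add_sum_erase _ _ (Finset.empty_mem_powerset A), adDiff_empty, Finset.sdiff_empty,
    Finset.union_empty, adDiff_shift, ← add_assoc, mul_add]
  apply add_nonneg
  · have a1 := mul_nonneg (sub_nonneg.mpr (h1 S)) (hF A S hA hk)
    have a2 := mul_nonneg (h0 S) (hF A (insert u S) hA hk)
    linarith
  · rw [Finset.mul_sum]
    refine Finset.sum_nonneg fun B hB => ?_
    rw [Finset.mem_erase, Finset.mem_powerset] at hB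
    have hBn : B.Nonempty := Finset.nonempty_iff_ne_empty.mpr hB.1
    have hc := Finset.card_sdiff_add_card_eq_card hB.2
    have hBp := hBn.card_pos
    have b1 := hf B S hBn (by omega)
    have b2 := hh (A \ B) (S ∪ B) (by omega)
    have := mul_nonneg b1 b2
    have e : (-1 : ℝ) ^ (A.card + 1) = (-1) ^ (B.card + 1) * (-1) ^ (A \ B).card := by
      rw [← pow_add]; congr 1; omega
    rw [e]
    linarith

lemma isADk_mem {V : Type*} [DecidableEq V] (v : V) (k : ℕ) :
    IsADk (fun S : Finset V => if v ∈ S then (1 : ℝ) else 0) k := by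
  intro A S ⟨a, ha⟩ _
  obtain ⟨A, haA, rfl⟩ : ∃ A₁, a ∉ A₁ ∧ A = insert a A₁ :=
    ⟨A.erase a, Finset.notMem_erase _ _, (Finset.insert_erase ha).symm⟩
  clear ha
  rw [adDiff_insert _ _ _ _ haA]
  by_cases hv : v = a
  · subst hv
    rcases A.eq_empty_or_nonempty with rfl | ⟨b, hb⟩
    · simp only [adDiff_empty]
      simp
      split_ifs <;> simp
    · have key : ∀ S, adDiff (fun S : Finset V => if v ∈ S then (1 : ℝ) else 0) A S = 0 := by
        intro S
        have hvb : v ≠ b := fun h => haA (h ▸ hb)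
        rw [← Finset.insert_erase hb, adDiff_insert _ _ _ _ (Finset.notMem_erase b A), sub_eq_zero]
        unfold adDiff
        refine Finset.sum_congr rfl fun B _ => ?_
        simp [hvb]
      simp [key]
  · have : adDiff (fun S : Finset V => if v ∈ S then (1 : ℝ) else 0) A (insert a S)
      = adDiff (fun S : Finset V => if v ∈ S then (1 : ℝ) else 0) A S := by
      unfold adDiff
      refine Finset.sum_congr rfl fun B _ => ?_
      simp [hv]
    rw [this]; simp

end ADHelpers

section SeqHelpers

/-- Process the nodes of a list one after another. -/
def seqSet {V : Type*} [Fintype V] [DecidableEq V] (gt : GTInstance V) (θ : V → ℝ) :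
    List V → Finset V → Finset V
  | [], S => S
  | u :: L, S => seqSet gt θ L (if θ u ≤ gt.f u S then insert u S else S)

lemma subset_seqSet {V : Type*} [Fintype V] [DecidableEq V] (gt : GTInstance V) (θ : V → ℝ)
    (L : List V) : ∀ S, S ⊆ seqSet gt θ L S := by
  induction L with
  | nil => intro S; exact Finset.Subset.refl _
  | cons u L ih =>
    intro S
    refine Finset.Subset.trans ?_ (ih _)
    split_ifs
    · exact Finset.subset_insert _ _
    · exact Finset.Subset.refl _

lemma mem_seqSet {V : Type*} [Fintype V] [DecidableEq V] (gt : GTInstance V) (θ : V → ℝ)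
    (L : List V) : ∀ S x, x ∈ seqSet gt θ L S → x ∈ S ∨ x ∈ L := by
  induction L with
  | nil => intro S x hx; exact Or.inl hx
  | cons u L ih =>
    intro S x hx
    rcases ih _ _ hx with h | h
    · split_ifs at h
      · rcases Finset.mem_insert.mp h with rfl | h
        · simp
        · exact Or.inl h
      · exact Or.inl h
    · simp [h]

lemma seqSet_closed {V : Type*} [Fintype V] [DecidableEq V] (gt : GTInstance V) (θ : V → ℝ)
    (L : List V) (hirr : ∀ u, ¬ gt.E u u) (hL : L.Pairwise fun u w => ¬ gt.E w u) :
    ∀ S, ∀ w ∈ L, θ w ≤ gt.f w (seqSet gt θ L S) → w ∈ seqSet gt θ L S := by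
  induction L with
  | nil => intro S w hw; simp at hw
  | cons u L ih =>
    intro S w hw hθ
    rw [List.pairwise_cons] at hL
    rcases List.mem_cons.mp hw with rfl | hw
    · have e : gt.f w (seqSet gt θ (w :: L) S) = gt.f w S := by
        rw [gt.f_local w S, gt.f_local w (seqSet gt θ (w :: L) S)]
        congr 1
        ext x
        simp only [Finset.mem_filter]
        constructor
        · rintro ⟨hx, hE⟩
          refine ⟨?_, hE⟩
          rcases mem_seqSet gt θ _ _ _ hx with h | h
          · exact h
          · rcases List.mem_cons.mp h with rfl | h
            · exact absurd hE (hirr _)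
            · exact absurd hE (hL.1 _ h)
        · rintro ⟨hx, hE⟩
          exact ⟨subset_seqSet _ _ _ _ hx, hE⟩
      rw [e] at hθ
      apply subset_seqSet gt θ L
      simp [hθ]
    · exact ih hL.2 _ w hw hθ

lemma seqSet_subset_cascade {V : Type*} [Fintype V] [DecidableEq V] (gt : GTInstance V)
    (θ : V → ℝ) (S₀ : Finset V) (L : List V) : ∀ S t, S ⊆ cascade gt θ S₀ t →
    seqSet gt θ L S ⊆ cascade gt θ S₀ (t + L.length) := by
  induction L with
  | nil => intro S t h; exact h
  | cons u L ih =>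
    intro S t h
    have := ih (if θ u ≤ gt.f u S then insert u S else S) (t + 1) ?_
    · rw [List.length_cons, show t + (L.length + 1) = t + 1 + L.length by omega]
      exact this
    · have hsub : S ⊆ cascade gt θ S₀ (t + 1) := h.trans (Finset.subset_union_left)
      split_ifs with hθ
      · refine Finset.insert_subset ?_ hsub
        apply Finset.mem_union_right
        simp only [Finset.mem_filter, Finset.mem_univ, true_and]
        exact hθ.trans (gt.f_mono u h)
      · exact hsub

lemma cascade_subset {V : Type*} [Fintype V] [DecidableEq V] (gt : GTInstance V)
    (θ : V → ℝ) (S X : Finset V) (hS : S ⊆ X) (hX : ∀ w, θ w ≤ gt.f w X → w ∈ X) :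
    ∀ t, cascade gt θ S t ⊆ X := by
  intro t
  induction t with
  | zero => exact hS
  | succ t ih =>
    refine Finset.union_subset ih fun w hw => ?_
    simp only [Finset.mem_filter, Finset.mem_univ, true_and] at hw
    exact hX w (hw.trans (gt.f_mono w ih))

lemma finalSet_eq_seqSet {V : Type*} [Fintype V] [DecidableEq V] (gt : GTInstance V) (θ : V → ℝ)
    (L : List V) (hirr : ∀ u, ¬ gt.E u u) (hL : L.Pairwise fun u w => ¬ gt.E w u)
    (hmem : ∀ u, u ∈ L) (hlen : L.length = Fintype.card V) (S : Finset V) :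
    finalSet gt θ S = seqSet gt θ L S := by
  apply Finset.Subset.antisymm
  · exact cascade_subset gt θ S _ (subset_seqSet _ _ _ _)
      (fun w => seqSet_closed gt θ L hirr hL S w (hmem w)) _
  · have := seqSet_subset_cascade gt θ S L S 0 (Finset.Subset.refl _)
    rw [zero_add, hlen] at this
    exact this

lemma seqSet_congr {V : Type*} [Fintype V] [DecidableEq V] (gt : GTInstance V) (θ θ₂ : V → ℝ)
    (L : List V) : (∀ u ∈ L, θ u = θ₂ u) → ∀ S, seqSet gt θ L S = seqSet gt θ₂ L S := by
  induction L with
  | nil => intro _ S; rfl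
  | cons u L ih =>
    intro h S
    simp only [seqSet]
    rw [h u (by simp)]
    exact ih (fun w hw => h w (by simp [hw])) _

lemma measurableSet_seqSet {V : Type*} [Fintype V] [DecidableEq V] (gt : GTInstance V) (v : V)
    (L : List V) : ∀ S, MeasurableSet {θ : V → ℝ | v ∈ seqSet gt θ L S} := by
  induction L with
  | nil => intro S; simp only [seqSet]; exact MeasurableSet.const _
  | cons u L ih =>
    intro S
    have e : {θ : V → ℝ | v ∈ seqSet gt θ (u :: L) S} =
        ({θ : V → ℝ | θ u ≤ gt.f u S} ∩ {θ | v ∈ seqSet gt θ L (insert u S)}) ∪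
        ({θ : V → ℝ | θ u ≤ gt.f u S}ᶜ ∩ {θ | v ∈ seqSet gt θ L S}) := by
      ext θ
      by_cases h : θ u ≤ gt.f u S <;> simp [seqSet, h]
    have hm : MeasurableSet {θ : V → ℝ | θ u ≤ gt.f u S} :=
      measurableSet_le (measurable_pi_apply u) measurable_const
    rw [e]
    exact (hm.inter (ih _)).union (hm.compl.inter (ih _))

instance cubeMeasure_prob {V : Type*} [Fintype V] : IsProbabilityMeasure (cubeMeasure V) := by
  have : IsProbabilityMeasure (volume.restrict (Set.Icc (0 : ℝ) 1)) := ⟨by simp⟩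
  unfold cubeMeasure
  infer_instance

lemma cube_indep {V : Type*} [Fintype V] [DecidableEq V] (u : V) (c : ℝ) (h0 : 0 ≤ c)
    (h1 : c ≤ 1) (B : Set (V → ℝ)) (hB : MeasurableSet B)
    (hdep : ∀ θ θ₂ : V → ℝ, (∀ w, w ≠ u → θ w = θ₂ w) → (θ ∈ B ↔ θ₂ ∈ B)) :
    (cubeMeasure V).real ({θ | θ u ≤ c} ∩ B) = c * (cubeMeasure V).real B := by
  have : IsProbabilityMeasure (volume.restrict (Set.Icc (0 : ℝ) 1)) := ⟨by simp⟩
  have hi : ProbabilityTheory.iIndepFun (fun (i : V) (θ : V → ℝ) => θ i) (cubeMeasure V) :=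
    ProbabilityTheory.iIndepFun_pi (μ := fun _ : V => volume.restrict (Set.Icc (0 : ℝ) 1))
      (X := fun _ x => x) (fun i => aemeasurable_id)
  have hi2 := hi.indepFun_finset {u} (Finset.univ.erase u) (by simp) (fun i => measurable_pi_apply i)
  let ext1 : (↥(Finset.univ.erase u : Finset V) → ℝ) → (V → ℝ) :=
    fun x w => if h : w ∈ (Finset.univ.erase u : Finset V) then x ⟨w, h⟩ else 0
  have hext : Measurable ext1 := by
    refine measurable_pi_lambda _ fun w => ?_
    by_cases h : w ∈ (Finset.univ.erase u : Finset V)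
    · simp only [ext1, h, dite_true]; exact measurable_pi_apply _
    · simp only [ext1, h, dite_false]; exact measurable_const
  have hc : Measurable (fun x : (({u} : Finset V) → ℝ) => x ⟨u, by simp⟩) := measurable_pi_apply _
  have hi3 := hi2.comp hc hext
  have key := hi3.measure_inter_preimage_eq_mul (Set.Iic c) B measurableSet_Iic hB
  have e2 : ((ext1 ∘ fun (a : V → ℝ) (i : (Finset.univ.erase u : Finset V)) => a i) ⁻¹' B) = B := by
    ext θ
    apply hdep
    intro w hw
    simp [ext1, hw]
  rw [e2] at key
  have e1 : (((fun x : (({u} : Finset V) → ℝ) => x ⟨u, by simp⟩) ∘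
      fun (a : V → ℝ) (i : ({u} : Finset V)) => a i) ⁻¹' (Set.Iic c)) = {θ | θ u ≤ c} := by
    ext θ; simp
  rw [e1] at key
  have hmp : MeasurePreserving (Function.eval u) (cubeMeasure V)
      (volume.restrict (Set.Icc (0 : ℝ) 1)) :=
    measurePreserving_eval (μ := fun _ : V => volume.restrict (Set.Icc (0 : ℝ) 1)) u
  have hm : (cubeMeasure V) {θ | θ u ≤ c} = ENNReal.ofReal c := by
    have := hmp.measure_preimage (measurableSet_Iic (a := c)).nullMeasurableSet
    have e3 : (Function.eval u : (V → ℝ) → ℝ) ⁻¹' (Set.Iic c) = {θ | θ u ≤ c} := rfl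
    rw [e3] at this
    rw [this, Measure.restrict_apply measurableSet_Iic]
    have e4 : Set.Iic c ∩ Set.Icc (0 : ℝ) 1 = Set.Icc 0 c := by
      ext x
      simp only [Set.mem_inter_iff, Set.mem_Iic, Set.mem_Icc]
      constructor
      · rintro ⟨a, b, _⟩; exact ⟨b, a⟩
      · rintro ⟨a, b⟩; exact ⟨b, a, b.trans h1⟩
    rw [e4, Real.volume_Icc, sub_zero]
  rw [measureReal_def, measureReal_def, key, hm, ENNReal.toReal_mul, ENNReal.toReal_ofReal h0]

lemma seqProb_isADk {V : Type*} [Fintype V] [DecidableEq V] (gt : GTInstance V) (k : ℕ)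
    (hloc : ∀ v, IsADk (gt.f v) k) (v : V) (L : List V) (hL : L.Nodup) :
    IsADk (fun S => (cubeMeasure V).real {θ | v ∈ seqSet gt θ L S}) k := by
  induction L with
  | nil =>
    convert isADk_mem v k using 2 with S
    by_cases h : v ∈ S <;> simp [seqSet, h]
  | cons u L ih =>
    rw [List.nodup_cons] at hL
    have := (ih hL.2).compose u (hloc u) (gt.f_nonneg u) (gt.f_le_one u)
    convert this using 2 with S
    have e : {θ : V → ℝ | v ∈ seqSet gt θ (u :: L) S} =
        ({θ : V → ℝ | θ u ≤ gt.f u S} ∩ {θ | v ∈ seqSet gt θ L (insert u S)}) ∪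
        ({θ | v ∈ seqSet gt θ L S} \ {θ : V → ℝ | θ u ≤ gt.f u S}) := by
      ext θ
      by_cases h : θ u ≤ gt.f u S <;> simp [seqSet, h]
    have hm : MeasurableSet {θ : V → ℝ | θ u ≤ gt.f u S} :=
      measurableSet_le (measurable_pi_apply u) measurable_const
    have hdep : ∀ S, ∀ θ θ₂ : V → ℝ, (∀ w, w ≠ u → θ w = θ₂ w) →
        (θ ∈ {θ : V → ℝ | v ∈ seqSet gt θ L S} ↔ θ₂ ∈ {θ : V → ℝ | v ∈ seqSet gt θ L S}) := by
      intro S θ θ₂ h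
      simp only [Set.mem_ofPred_eq]
      rw [seqSet_congr gt θ θ₂ L (fun w hw => h w (fun e => hL.1 (e ▸ hw)))]
    have hms := measurableSet_seqSet gt v L
    have c1 := cube_indep u _ (gt.f_nonneg u S) (gt.f_le_one u S) _ (hms (insert u S)) (hdep _)
    have c2 := cube_indep u _ (gt.f_nonneg u S) (gt.f_le_one u S) _ (hms S) (hdep _)
    have c3 := measureReal_inter_add_sdiff (μ := cubeMeasure V)
      (s := {θ : V → ℝ | v ∈ seqSet gt θ L S}) hm
    rw [e, measureReal_union _ ((hms S).diff hm), c1]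
    · rw [Set.inter_comm, c2] at c3
      linarith
    · exact Set.disjoint_left.mpr fun θ h1 h2 => h2.2 h1.1

end SeqHelpers

/-- In the general threshold model on a layered graph whose threshold functions are all
AD-`k`, for every node `v` the function `S_m ↦ P_v(S_m)` on subsets of the bottom layer
`V_m` is AD-`k` as a set function on `2^{V_m}`. -/
theorem layered_bottom_seed_activationProb_ADk
    {V : Type*} [Fintype V] [DecidableEq V] (gt : GTInstance V)
    (m : ℕ) (layer : V → ℕ) (hlay : IsLayered gt m layer) (k : ℕ)
    (hloc : ∀ v, IsADk (gt.f v) k) (v : V) :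
    IsADkOn (Finset.univ.filter fun u => layer u = m)
      (fun Sm => activationProb gt v Sm) k := by
  obtain ⟨-, -, hE⟩ := hlay
  have hirr : ∀ u, ¬ gt.E u u := fun u h => by have := hE u u h; omega
  let L : List V := (Finset.univ : Finset V).toList.mergeSort
    (fun a b => decide (layer b ≤ layer a))
  have hperm : L.Perm (Finset.univ : Finset V).toList := List.mergeSort_perm _ _
  have hpw : L.Pairwise fun u w => ¬ gt.E w u := by
    have := List.pairwise_mergeSort (le := fun a b : V => decide (layer b ≤ layer a))
      (fun a b c h1 h2 => by simp only [decide_eq_true_eq] at *; omega)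
      (fun a b => by simp only [Bool.or_eq_true, decide_eq_true_eq]; omega)
      (Finset.univ : Finset V).toList
    refine List.Pairwise.imp (fun {a b} hab h => ?_) this
    have := hE _ _ h
    simp only [decide_eq_true_eq] at hab
    omega
  have hnd : L.Nodup := hperm.nodup_iff.mpr (Finset.nodup_toList _)
  have hmem : ∀ u, u ∈ L := fun u => hperm.mem_iff.mpr (by simp)
  have hlen : L.length = Fintype.card V := by rw [hperm.length_eq]; simp
  have key := seqProb_isADk gt k hloc v L hnd
  have e : (fun S => activationProb gt v S)
      = fun S => (cubeMeasure V).real {θ | v ∈ seqSet gt θ L S} := by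
    funext S
    simp only [activationProb, finalSet_eq_seqSet gt _ L hirr hpw hmem hlen, measureReal_def]
  rw [e]
  exact fun A S _ _ hA hk => key A S hA hk

end
end

section
/- Let Gt = (V, E, {f_v}) be a general threshold instance in which every threshold function f_v is AD-∞. Then for every node u ∈ V and every S ⊆ V, the quantity ∑_{T ⊆ S} (-1)^{|S| − |T|} (1 − P_u(V \ T)) lies in the interval [0, 1]; that is, there exists a function R_u : 2^V → [0,1] with R_u(S) = ∑_{T ⊆ S} (-1)^{|S| − |T|} (1 − P_u(V \ T)) for all S ⊆ V. -/
open MeasureTheory Finset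
open scoped Classical

noncomputable section


variable {V : Type*} [Fintype V] [DecidableEq V]

section Moebius

/-- Moebius transform of a set function. -/
def moeb {V : Type*} [DecidableEq V] (h : Finset V → ℝ) (S : Finset V) : ℝ :=
  ∑ T ∈ S.powerset, (-1 : ℝ) ^ (S.card - T.card) * h T

theorem moeb_insert {V : Type*} [DecidableEq V] (h : Finset V → ℝ) (a : V) (S : Finset V)
    (ha : a ∉ S) : moeb h (insert a S) = moeb (fun T => h (insert a T)) S - moeb h S := by
  unfold moeb
  rw [Finset.sum_powerset_insert ha, add_comm, sub_eq_add_neg, ← Finset.sum_neg_distrib]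
  congr 1
  · refine Finset.sum_congr rfl fun T hT => ?_
    have hT' := Finset.mem_powerset.1 hT
    rw [Finset.card_insert_of_notMem ha, Finset.card_insert_of_notMem (fun h => ha (hT' h))]
    congr 2
    omega
  · refine Finset.sum_congr rfl fun T hT => ?_
    have hT' := Finset.card_le_card (Finset.mem_powerset.1 hT)
    rw [Finset.card_insert_of_notMem ha, Nat.succ_sub hT', pow_succ]
    ring

theorem sum_moeb {V : Type*} [DecidableEq V] (A : Finset V) : ∀ h : Finset V → ℝ,
    ∑ T ∈ A.powerset, moeb h T = h A := by
  induction A using Finset.induction_on with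
  | empty => intro h; simp [moeb]
  | insert a A ha ih =>
    intro h
    rw [Finset.sum_powerset_insert ha, ← ih (fun T => h (insert a T)), ← Finset.sum_add_distrib]
    refine Finset.sum_congr rfl fun T hT => ?_
    rw [moeb_insert h a T (fun h => ha (Finset.mem_powerset.1 hT h))]
    ring

theorem moeb_sum {V : Type*} [DecidableEq V] (p : Finset V → ℝ) (A : Finset V) :
    moeb (fun B => ∑ T ∈ B.powerset, p T) A = p A := by
  induction A using Finset.strongInduction with
  | H A ih =>
    have h := sum_moeb A (fun B => ∑ T ∈ B.powerset, p T)
    rw [← Finset.sum_erase_add _ _ (Finset.mem_powerset_self A),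
      ← Finset.sum_erase_add _ _ (Finset.mem_powerset_self A)] at h
    have h2 : ∑ T ∈ A.powerset.erase A, moeb (fun B => ∑ T ∈ B.powerset, p T) T
        = ∑ T ∈ A.powerset.erase A, p T := by
      refine Finset.sum_congr rfl fun T hT => ih T ?_
      rw [Finset.mem_erase, Finset.mem_powerset] at hT
      exact lt_of_le_of_ne hT.2 hT.1
    linarith

end Moebius

section Systems

/-- `A` is closed relative to `W`. -/
def sysClosed {V : Type*} [DecidableEq V] {Ω : V → Type*} (act : ∀ v, Finset V → Set (Ω v))
    (ω : ∀ v, Ω v) (W A : Finset V) : Prop := ∀ v ∈ W \ A, ω v ∉ act v A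

/-- the cascade inside `A` started at `S` fills `A`. -/
def sysFill {V : Type*} [DecidableEq V] {Ω : V → Type*} (act : ∀ v, Finset V → Set (Ω v))
    (ω : ∀ v, Ω v) (S A : Finset V) : Prop :=
  S ⊆ A ∧ ∀ B, S ⊆ B → B ⊂ A → ∃ v ∈ A \ B, ω v ∈ act v B

theorem sysFill_subset {V : Type*} [DecidableEq V] {Ω : V → Type*}
    (act : ∀ v, Finset V → Set (Ω v)) (hmono : ∀ v, Monotone (act v))
    (ω : ∀ v, Ω v) (S A W B : Finset V) (hA : sysFill act ω S A) (hAW : A ⊆ W)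
    (hSB : S ⊆ B) (hB : sysClosed act ω W B) : A ⊆ B := by
  by_contra hAB
  obtain ⟨v, hv, hv2⟩ := hA.2 (A ∩ B) (Finset.subset_inter hA.1 hSB)
    (Finset.ssubset_iff_subset_ne.2 ⟨Finset.inter_subset_left,
      fun h => hAB (Finset.inter_eq_left.1 h)⟩)
  have hv' : v ∈ A ∧ v ∉ B := by
    simp only [Finset.mem_sdiff, Finset.mem_inter] at hv
    tauto
  exact hB v (Finset.mem_sdiff.2 ⟨hAW hv'.1, hv'.2⟩) (hmono v Finset.inter_subset_right hv2)

theorem sys_exists {V : Type*} [DecidableEq V] {Ω : V → Type*}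
    (act : ∀ v, Finset V → Set (Ω v)) (hmono : ∀ v, Monotone (act v))
    (ω : ∀ v, Ω v) (S W : Finset V) (hSW : S ⊆ W) :
    ∃ A, A ⊆ W ∧ sysFill act ω S A ∧ sysClosed act ω W A := by
  let P := W.powerset.filter (fun A => S ⊆ A ∧ sysClosed act ω W A)
  have hP : P.Nonempty := ⟨W, by
    simp only [P, Finset.mem_filter, Finset.mem_powerset]
    exact ⟨subset_rfl, hSW, fun v hv => by simp at hv⟩⟩
  obtain ⟨A, hA, hmin⟩ := Finset.exists_min_image P Finset.card hP
  simp only [P, Finset.mem_filter, Finset.mem_powerset] at hA hmin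
  refine ⟨A, hA.1, ⟨hA.2.1, fun B hSB hBA => ?_⟩, hA.2.2⟩
  by_contra hcon
  push Not at hcon
  have hcl : sysClosed act ω W B := by
    intro v hv hvB
    rw [Finset.mem_sdiff] at hv
    by_cases hvA : v ∈ A
    · exact hcon v (Finset.mem_sdiff.2 ⟨hvA, hv.2⟩) hvB
    · exact hA.2.2 v (Finset.mem_sdiff.2 ⟨hv.1, hvA⟩) (hmono v hBA.1 hvB)
  have := hmin B ⟨hBA.1.trans hA.1, hSB, hcl⟩
  exact absurd (Finset.card_lt_card hBA) (by omega)

theorem measurableSet_sysClosed {V : Type*} [Fintype V] [DecidableEq V] {Ω : V → Type*}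
    [∀ v, MeasurableSpace (Ω v)]
    (act : ∀ v, Finset V → Set (Ω v)) (hact : ∀ v A, MeasurableSet (act v A))
    (W A : Finset V) : MeasurableSet {ω | sysClosed act ω W A} := by
  unfold sysClosed
  measurability

theorem measurableSet_sysFill {V : Type*} [Fintype V] [DecidableEq V] {Ω : V → Type*}
    [∀ v, MeasurableSpace (Ω v)]
    (act : ∀ v, Finset V → Set (Ω v)) (hact : ∀ v A, MeasurableSet (act v A))
    (S A : Finset V) : MeasurableSet {ω | sysFill act ω S A} := by
  unfold sysFill
  measurability

theorem sys_indep {V : Type*} [Fintype V] [DecidableEq V] {Ω : V → Type*}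
    [∀ v, MeasurableSpace (Ω v)] (μ : ∀ v, Measure (Ω v)) [∀ v, IsProbabilityMeasure (μ v)]
    (act : ∀ v, Finset V → Set (Ω v)) (hact : ∀ v A, MeasurableSet (act v A))
    (S A W : Finset V) :
    (Measure.pi μ).real ({ω | sysFill act ω S A} ∩ {ω | sysClosed act ω W A}) =
      (Measure.pi μ).real {ω | sysFill act ω S A} *
        ∏ v ∈ W \ A, (1 - (μ v).real (act v A)) := by
  have hind : ProbabilityTheory.iIndepFun (fun v (ω : ∀ v, Ω v) => ω v) (Measure.pi μ) :=
    ProbabilityTheory.iIndepFun_pi (X := fun v (x : Ω v) => x) (fun v => aemeasurable_id)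
  have h2 := hind.indepFun_finset A (W \ A) Finset.disjoint_sdiff (fun v => measurable_pi_apply v)
  let FA : Set (∀ v : A, Ω v) := {x | S ⊆ A ∧ ∀ B, S ⊆ B → B ⊂ A → ∃ v : A, v.1 ∉ B ∧ x v ∈ act v B}
  let CA : Set (∀ v : (W \ A : Finset V), Ω v) := {x | ∀ v : (W \ A : Finset V), x v ∉ act v A}
  have hFA : MeasurableSet FA := by
    simp only [FA]
    measurability
  have hCA : MeasurableSet CA := by
    simp only [CA]
    measurability
  have e1 : {ω | sysFill act ω S A} = (fun (ω : ∀ v, Ω v) (v : A) => ω v) ⁻¹' FA := by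
    ext ω
    simp only [sysFill, FA, Set.mem_ofPred_eq, Set.mem_preimage, Subtype.exists, Finset.mem_sdiff]
    grind
  have e2 : {ω | sysClosed act ω W A} =
      (fun (ω : ∀ v, Ω v) (v : (W \ A : Finset V)) => ω v) ⁻¹' CA := by
    ext ω
    simp [sysClosed, CA]
  have e3 : {ω | sysClosed act ω W A} =
      Set.pi Set.univ (fun v => if v ∈ W \ A then (act v A)ᶜ else Set.univ) := by
    ext ω
    simp only [sysClosed, Set.mem_ofPred_eq, Set.mem_pi, Set.mem_univ, true_imp_iff]
    refine forall_congr' fun v => ?_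
    split_ifs with h <;> simp [h]
  have e4 : (Measure.pi μ).real {ω | sysClosed act ω W A} =
      ∏ v ∈ W \ A, (1 - (μ v).real (act v A)) := by
    rw [e3, measureReal_def, Measure.pi_pi, ENNReal.toReal_prod,
      ← Finset.prod_subset (Finset.subset_univ (W \ A))]
    · refine Finset.prod_congr rfl fun v hv => ?_
      rw [if_pos hv, ← measureReal_def, probReal_compl_eq_one_sub (hact v A)]
    · intro v _ hv
      rw [if_neg hv]; simp
  have h3 := h2.measure_inter_preimage_eq_mul FA CA hFA hCA
  rw [← e1, ← e2] at h3
  rw [← e4, measureReal_def, h3, ENNReal.toReal_mul]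
  rfl

theorem sys_sum {V : Type*} [Fintype V] [DecidableEq V] {Ω : V → Type*}
    [∀ v, MeasurableSpace (Ω v)] (μ : ∀ v, Measure (Ω v)) [∀ v, IsProbabilityMeasure (μ v)]
    (act : ∀ v, Finset V → Set (Ω v)) (hmono : ∀ v, Monotone (act v))
    (hact : ∀ v A, MeasurableSet (act v A))
    (S W : Finset V) (Q : Finset (Finset V)) (hQ : ∀ A ∈ Q, A ⊆ W) :
    (Measure.pi μ).real {ω | ∃ A ∈ Q, sysFill act ω S A ∧ sysClosed act ω W A} =
      ∑ A ∈ Q, (Measure.pi μ).real {ω | sysFill act ω S A} *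
        ∏ v ∈ W \ A, (1 - (μ v).real (act v A)) := by
  have e : {ω | ∃ A ∈ Q, sysFill act ω S A ∧ sysClosed act ω W A} =
      ⋃ A ∈ Q, ({ω | sysFill act ω S A} ∩ {ω | sysClosed act ω W A}) := by
    ext ω; simp only [Set.mem_ofPred_eq, Set.mem_iUnion, Set.mem_inter_iff, exists_prop]
  rw [e, measureReal_biUnion_finset]
  · exact Finset.sum_congr rfl fun A _ => sys_indep μ act hact S A W
  · intro A hA B hB hAB
    refine Set.disjoint_left.2 fun ω h1 h2 => hAB ?_
    exact Finset.Subset.antisymm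
      (sysFill_subset act hmono ω S A W B h1.1 (hQ A hA) h2.1.1 h2.2)
      (sysFill_subset act hmono ω S B W A h2.1 (hQ B hB) h1.1.1 h1.2)
  · intro A _
    exact (measurableSet_sysFill act hact S A).inter (measurableSet_sysClosed act hact W A)

theorem sys_fill_eq {V : Type*} [Fintype V] [DecidableEq V] {Ω Ω' : V → Type*}
    [∀ v, MeasurableSpace (Ω v)] (μ : ∀ v, Measure (Ω v)) [∀ v, IsProbabilityMeasure (μ v)]
    (act : ∀ v, Finset V → Set (Ω v)) (hmono : ∀ v, Monotone (act v))
    (hact : ∀ v A, MeasurableSet (act v A))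
    [∀ v, MeasurableSpace (Ω' v)] (μ' : ∀ v, Measure (Ω' v)) [∀ v, IsProbabilityMeasure (μ' v)]
    (act' : ∀ v, Finset V → Set (Ω' v)) (hmono' : ∀ v, Monotone (act' v))
    (hact' : ∀ v A, MeasurableSet (act' v A))
    (heq : ∀ v A, (μ v).real (act v A) = (μ' v).real (act' v A))
    (S W : Finset V) :
    (Measure.pi μ).real {ω | sysFill act ω S W} = (Measure.pi μ').real {ω | sysFill act' ω S W} := by
  induction W using Finset.strongInduction with
  | H W ih =>
    by_cases hSW : S ⊆ W
    · have h1 := sys_sum μ act hmono hact S W W.powerset (fun A hA => Finset.mem_powerset.1 hA)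
      have h2 := sys_sum μ' act' hmono' hact' S W W.powerset (fun A hA => Finset.mem_powerset.1 hA)
      have u1 : {ω | ∃ A ∈ W.powerset, sysFill act ω S A ∧ sysClosed act ω W A} = Set.univ := by
        refine Set.eq_univ_of_forall fun ω => ?_
        simpa using sys_exists act hmono ω S W hSW
      have u2 : {ω | ∃ A ∈ W.powerset, sysFill act' ω S A ∧ sysClosed act' ω W A} = Set.univ := by
        refine Set.eq_univ_of_forall fun ω => ?_
        simpa using sys_exists act' hmono' ω S W hSW
      rw [u1, probReal_univ, ← Finset.sum_erase_add _ _ (Finset.mem_powerset_self W)] at h1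
      rw [u2, probReal_univ, ← Finset.sum_erase_add _ _ (Finset.mem_powerset_self W)] at h2
      have h3 : ∑ A ∈ W.powerset.erase W, (Measure.pi μ).real {ω | sysFill act ω S A} *
          ∏ v ∈ W \ A, (1 - (μ v).real (act v A)) =
          ∑ A ∈ W.powerset.erase W, (Measure.pi μ').real {ω | sysFill act' ω S A} *
          ∏ v ∈ W \ A, (1 - (μ' v).real (act' v A)) := by
        refine Finset.sum_congr rfl fun T hT => ?_
        rw [Finset.mem_erase, Finset.mem_powerset] at hT
        rw [ih T (lt_of_le_of_ne hT.2 hT.1)]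
        simp only [heq]
      simp only [Finset.sdiff_self, Finset.prod_empty, mul_one] at h1 h2
      linarith
    · simp [sysFill, hSW]

/-- The event that `u` stays inactive from seed `S`. -/
def sysOff {V : Type*} [Fintype V] [DecidableEq V] {Ω : V → Type*}
    (act : ∀ v, Finset V → Set (Ω v)) (u : V) (S : Finset V) : Set (∀ v, Ω v) :=
  {ω | ∃ B, S ⊆ B ∧ u ∉ B ∧ ∀ v, v ∉ B → ω v ∉ act v B}

theorem sysOff_eq {V : Type*} [Fintype V] [DecidableEq V] {Ω : V → Type*}
    [∀ v, MeasurableSpace (Ω v)] (μ : ∀ v, Measure (Ω v)) [∀ v, IsProbabilityMeasure (μ v)]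
    (act : ∀ v, Finset V → Set (Ω v)) (hmono : ∀ v, Monotone (act v))
    (hact : ∀ v A, MeasurableSet (act v A)) (u : V)
    (S : Finset V) : (Measure.pi μ).real (sysOff act u S) =
      ∑ A ∈ Finset.univ.filter (fun A : Finset V => u ∉ A),
        (Measure.pi μ).real {ω | sysFill act ω S A} *
        ∏ v ∈ Finset.univ \ A, (1 - (μ v).real (act v A)) := by
  rw [← sys_sum μ act hmono hact S _ _ (fun A _ => Finset.subset_univ A)]
  congr 1
  ext ω
  simp only [sysOff, Set.mem_ofPred_eq, Finset.mem_filter, Finset.mem_univ, true_and]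
  constructor
  · rintro ⟨B, hSB, huB, hB⟩
    obtain ⟨A, -, hf, hc⟩ := sys_exists act hmono ω S _ (Finset.subset_univ S)
    have := sysFill_subset act hmono ω S A Finset.univ B hf (Finset.subset_univ _) hSB
      (fun v hv => hB v (by simpa using hv))
    exact ⟨A, fun h => huB (this h), hf, hc⟩
  · rintro ⟨A, huA, hf, hc⟩
    exact ⟨A, hf.1, huA, fun v hv => hc v (by simpa using hv)⟩

end Systems

section GT

theorem cascade_le {V : Type*} [Fintype V] [DecidableEq V] (gt : GTInstance V) (θ : V → ℝ)
    (S B : Finset V) (hSB : S ⊆ B) (hB : ∀ v, v ∉ B → ¬ θ v ≤ gt.f v B) (t : ℕ) :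
    cascade gt θ S t ⊆ B := by
  induction t with
  | zero => exact hSB
  | succ t ih =>
    intro v hv
    simp only [cascade, Finset.mem_union, Finset.mem_filter, Finset.mem_univ, true_and] at hv
    rcases hv with hv | hv
    · exact ih hv
    · by_contra hvB
      exact hB v hvB (hv.trans (gt.f_mono v ih))

theorem subset_cascade {V : Type*} [Fintype V] [DecidableEq V] (gt : GTInstance V) (θ : V → ℝ)
    (S : Finset V) (t : ℕ) : S ⊆ cascade gt θ S t := by
  induction t with
  | zero => exact subset_rfl
  | succ t ih => exact ih.trans Finset.subset_union_left

theorem cascade_stab {V : Type*} [Fintype V] [DecidableEq V] (gt : GTInstance V) (θ : V → ℝ)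
    (S : Finset V) (t : ℕ) : t ≤ (cascade gt θ S t).card ∨
      cascade gt θ S (t + 1) = cascade gt θ S t := by
  induction t with
  | zero => left; simp
  | succ t ih =>
    by_cases h : cascade gt θ S (t + 1) = cascade gt θ S t
    · right
      rw [cascade, h]
      exact h
    · left
      have h1 := ih.resolve_right h
      have h2 : cascade gt θ S t ⊂ cascade gt θ S (t + 1) :=
        lt_of_le_of_ne Finset.subset_union_left (Ne.symm h)
      have := Finset.card_lt_card h2
      omega

theorem finalSet_closed {V : Type*} [Fintype V] [DecidableEq V] (gt : GTInstance V) (θ : V → ℝ)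
    (S : Finset V) (v : V) (hv : v ∉ finalSet gt θ S) : ¬ θ v ≤ gt.f v (finalSet gt θ S) := by
  intro h
  rcases cascade_stab gt θ S (Fintype.card V) with h1 | h1
  · have : finalSet gt θ S = Finset.univ :=
      (Finset.card_eq_iff_eq_univ _).1 (le_antisymm (Finset.card_le_univ _) h1)
    rw [this] at hv
    exact hv (Finset.mem_univ v)
  · apply hv
    unfold finalSet at h ⊢
    rw [← h1, cascade]
    simp [h]

/-- threshold activation sets -/
def gtAct {V : Type*} [Fintype V] [DecidableEq V] (gt : GTInstance V) (v : V) (C : Finset V) :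
    Set ℝ := Set.Iic (gt.f v C)

instance isProb_unit : IsProbabilityMeasure (volume.restrict (Set.Icc (0 : ℝ) 1)) :=
  ⟨by simp⟩

theorem gtAct_real {V : Type*} [Fintype V] [DecidableEq V] (gt : GTInstance V) (v : V)
    (C : Finset V) : (volume.restrict (Set.Icc (0 : ℝ) 1)).real (gtAct gt v C) = gt.f v C := by
  have h0 := gt.f_nonneg v C
  have h1 := gt.f_le_one v C
  rw [measureReal_restrict_apply (show MeasurableSet (gtAct gt v C) from measurableSet_Iic)]
  have : gtAct gt v C ∩ Set.Icc 0 1 = Set.Icc 0 (gt.f v C) := by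
    ext x
    simp only [gtAct, Set.mem_inter_iff, Set.mem_Iic, Set.mem_Icc]
    constructor
    · rintro ⟨a, b, c⟩; exact ⟨b, a⟩
    · rintro ⟨a, b⟩; exact ⟨b, a, b.trans h1⟩
  rw [this]
  simp [measureReal_def, h0]

theorem gt_off {V : Type*} [Fintype V] [DecidableEq V] (gt : GTInstance V) (u : V)
    (S : Finset V) : 1 - activationProb gt u S =
      (Measure.pi fun _ : V => volume.restrict (Set.Icc (0 : ℝ) 1)).real
        (sysOff (Ω := fun _ => ℝ) (gtAct gt) u S) := by
  have e : {θ | u ∈ finalSet gt θ S} = (sysOff (Ω := fun _ => ℝ) (gtAct gt) u S)ᶜ := by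
    ext θ
    simp only [sysOff, Set.mem_ofPred_eq, Set.mem_compl_iff, gtAct, Set.mem_Iic]
    constructor
    · rintro hu ⟨B, hSB, huB, hB⟩
      exact huB (cascade_le gt θ S B hSB hB _ hu)
    · intro h
      by_contra hu
      exact h ⟨finalSet gt θ S, subset_cascade gt θ S _, hu, finalSet_closed gt θ S⟩
  have hm : MeasurableSet (sysOff (Ω := fun _ => ℝ) (gtAct gt) u S) := by
    have : sysOff (Ω := fun _ => ℝ) (gtAct gt) u S =
      ⋃ B ∈ {B : Finset V | S ⊆ B ∧ u ∉ B}, {ω | sysClosed (Ω := fun _ => ℝ) (gtAct gt) ω Finset.univ B} := by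
      ext ω
      simp [sysOff, sysClosed, and_assoc]
    rw [this]
    exact MeasurableSet.biUnion (Set.to_countable _) fun B _ =>
      measurableSet_sysClosed _ (fun _ _ => measurableSet_Iic) _ _
  rw [activationProb, e, cubeMeasure, ← measureReal_def, probReal_compl_eq_one_sub hm]
  ring

end GT

section Trigger

/-- discrete measurable structure on subsets -/
instance trigMS {V : Type*} : MeasurableSpace (Finset V) := ⊤

instance trigDMS {V : Type*} : DiscreteMeasurableSpace (Finset V) := ⟨fun _ => trivial⟩

/-- triggering activation sets -/
def trAct {V : Type*} [DecidableEq V] (_ : V) (C : Finset V) : Set (Finset V) :=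
  {T | ¬ Disjoint T C}

theorem tr_exists {V : Type*} [Fintype V] [DecidableEq V] (f : Finset V → ℝ)
    (hf1 : ∀ S, f S ≤ 1) (hf0 : f ∅ = 0) (had : IsADk f (Fintype.card V)) :
    ∃ μ : Measure (Finset V), IsProbabilityMeasure μ ∧
      ∀ v C, f C = μ.real (trAct v C) := by
  let h : Finset V → ℝ := fun T => 1 - f (Finset.univ \ T)
  have hnn : ∀ T, 0 ≤ moeb h T := by
    intro T
    by_cases hT : T.Nonempty
    · have h1 := had T (Finset.univ \ T) hT (Finset.card_le_univ T)
      have h2 : moeb h T = (-1 : ℝ) ^ (T.card + 1) * adDiff f T (Finset.univ \ T) := by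
        have hz : ∑ B ∈ T.powerset, (-1 : ℝ) ^ B.card = 0 := by
          have := Finset.sum_powerset_neg_one_pow_card_of_nonempty hT
          exact_mod_cast this
        have hs : ∀ B ∈ T.powerset, (-1 : ℝ) ^ (T.card - B.card) * h B =
            (-1 : ℝ) ^ T.card * (-1 : ℝ) ^ B.card + (-1 : ℝ) ^ (T.card + 1) *
              ((-1 : ℝ) ^ B.card * f (Finset.univ \ T ∪ (T \ B))) := by
          intro B hB
          rw [Finset.mem_powerset] at hB
          have hc := Finset.card_le_card hB
          have e1 : Finset.univ \ T ∪ (T \ B) = Finset.univ \ B := by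
            ext x
            simp only [Finset.mem_union, Finset.mem_sdiff, Finset.mem_univ, true_and]
            have := @hB x
            tauto
          have e2 : (-1 : ℝ) ^ (T.card - B.card) = (-1 : ℝ) ^ T.card * (-1 : ℝ) ^ B.card := by
            obtain ⟨k, hk⟩ := Nat.exists_eq_add_of_le hc
            rw [hk, Nat.add_sub_cancel_left, pow_add]
            have : (-1 : ℝ) ^ B.card * (-1 : ℝ) ^ B.card = 1 := by
              rw [← mul_pow]; simp
            linear_combination (-(-1 : ℝ) ^ k) * this
          rw [e1, e2, pow_succ]
          simp only [h]
          ring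
        rw [moeb, Finset.sum_congr rfl hs, Finset.sum_add_distrib, ← Finset.mul_sum, hz,
          ← Finset.mul_sum, adDiff]
        ring
      rw [h2]; exact h1
    · rw [Finset.not_nonempty_iff_eq_empty] at hT
      subst hT
      simp [moeb, h, hf1]
  have hsum : ∑ T : Finset V, moeb h T = 1 := by
    have := sum_moeb (Finset.univ : Finset V) h
    rw [Finset.powerset_univ] at this
    simp [this, h, hf0]
  have hsum' : ∑ T : Finset V, ENNReal.ofReal (moeb h T) = 1 := by
    rw [← ENNReal.ofReal_sum_of_nonneg (fun T _ => hnn T), hsum, ENNReal.ofReal_one]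
  let p := PMF.ofFintype _ hsum'
  refine ⟨p.toMeasure, inferInstance, fun v C => ?_⟩
  have hc : p.toMeasure.real (trAct v C)ᶜ = 1 - f C := by
    have : (trAct v C)ᶜ = (((Finset.univ \ C).powerset : Finset (Finset V)) : Set (Finset V)) := by
      ext T
      simp only [trAct, Set.mem_compl_iff, Set.mem_ofPred_eq, not_not, Finset.coe_powerset,
        Set.mem_preimage, Set.mem_powerset_iff, Finset.coe_subset, Finset.subset_sdiff,
        Finset.subset_univ, true_and]
    rw [this, measureReal_def, PMF.toMeasure_apply_finset]
    simp only [p, PMF.ofFintype_apply]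
    rw [← ENNReal.ofReal_sum_of_nonneg (fun T _ => hnn T), sum_moeb,
      ENNReal.toReal_ofReal]
    · simp [h]
    · simp [h, hf1]
  rw [probReal_compl_eq_one_sub (MeasurableSet.of_discrete)] at hc
  linarith

/-- reverse reachable set -/
def rrSet {V : Type*} [Fintype V] [DecidableEq V] (u : V) (ω : V → Finset V) : Finset V :=
  Finset.univ.filter fun w => ∀ D : Finset V, u ∈ D → (∀ v ∈ D, ω v ⊆ D) → w ∈ D

theorem tr_off {V : Type*} [Fintype V] [DecidableEq V] (u : V) (T : Finset V) :
    sysOff (Ω := fun _ => Finset V) trAct u (Finset.univ \ T) = rrSet u ⁻¹' (T.powerset : Finset (Finset V)) := by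
  ext ω
  simp only [sysOff, trAct, Set.mem_ofPred_eq, not_not, Set.mem_preimage, Finset.mem_coe,
    Finset.mem_powerset]
  constructor
  · rintro ⟨B, hSB, huB, hB⟩ w hw
    simp only [rrSet, Finset.mem_filter, Finset.mem_univ, true_and] at hw
    have := hw Bᶜ (by simpa using huB) (fun v hv x hx => by
      simp only [Finset.mem_compl] at hv ⊢
      exact Finset.disjoint_left.1 (hB v hv) hx)
    by_contra hwT
    exact (Finset.mem_compl.1 this) (hSB (by simpa using hwT))
  · intro h
    refine ⟨(rrSet u ω)ᶜ, ?_, ?_, ?_⟩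
    · intro x hx
      simp only [Finset.mem_sdiff, Finset.mem_univ, true_and] at hx
      exact Finset.mem_compl.2 fun h' => hx (h h')
    · simp only [Finset.mem_compl, not_not]
      simp only [rrSet, Finset.mem_filter, Finset.mem_univ, true_and]
      exact fun D hD _ => hD
    · intro v hv
      rw [Finset.mem_compl, not_not] at hv
      refine Finset.disjoint_left.2 fun x hx => ?_
      rw [Finset.mem_compl, not_not]
      simp only [rrSet, Finset.mem_filter, Finset.mem_univ, true_and] at hv ⊢
      exact fun D hD hcl => hcl v (hv D hD hcl) hx

end Trigger

/-- For a locally AD-∞ general threshold instance, for every node `u` and every `S ⊆ V`,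
`∑_{T ⊆ S} (-1)^{|S|-|T|} (1 - P_u(V \ T))` lies in `[0,1]`; that is, there is a function
`R_u : 2^V → [0,1]` with `R_u(S) = ∑_{T ⊆ S} (-1)^{|S|-|T|} (1 - P_u(V \ T))`. -/
theorem exists_Ru_of_locally_ADinfty
    {V : Type*} [Fintype V] [DecidableEq V] (gt : GTInstance V)
    (hloc : ∀ v, IsADk (gt.f v) (Fintype.card V)) (u : V) (S : Finset V) :
    (∑ T ∈ S.powerset, (-1 : ℝ) ^ (S.card - T.card) *
        (1 - activationProb gt u (Finset.univ \ T))) ∈ Set.Icc (0 : ℝ) 1 := by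
  choose μ hμ hμf using fun v => tr_exists (gt.f v) (gt.f_le_one v) (gt.f_empty v) (hloc v)
  have hmono1 : ∀ v, Monotone (gtAct gt v) := fun v A B hAB =>
    Set.Iic_subset_Iic.2 (gt.f_mono v hAB)
  have hmono2 : ∀ v : V, Monotone (trAct v) := fun v A B hAB T hT h =>
    hT (h.mono_right hAB)
  have hm1 : ∀ v A, MeasurableSet (gtAct gt v A) := fun v A => measurableSet_Iic
  have hm2 : ∀ (v : V) A, MeasurableSet (trAct v A) := fun v A => MeasurableSet.of_discrete
  have heq : ∀ v A, (volume.restrict (Set.Icc (0 : ℝ) 1)).real (gtAct gt v A) =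
      (μ v).real (trAct v A) := fun v A => by rw [gtAct_real, ← hμf v v A]
  have key : ∀ T : Finset V, 1 - activationProb gt u (Finset.univ \ T) =
      ∑ D ∈ T.powerset, (Measure.pi μ).real (rrSet u ⁻¹' {D}) := by
    intro T
    rw [sum_measureReal_preimage_singleton _ (fun D _ => Set.Finite.measurableSet (Set.toFinite _)),
      ← tr_off, gt_off, sysOff_eq _ _ hmono1 hm1, sysOff_eq _ _ hmono2 hm2]
    refine Finset.sum_congr rfl fun A _ => ?_
    rw [sys_fill_eq (Ω := fun _ => ℝ) (Ω' := fun _ => Finset V) _ _ hmono1 hm1 μ _ hmono2 hm2 heq]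
    simp only [heq]
  have fin : (∑ T ∈ S.powerset, (-1 : ℝ) ^ (S.card - T.card) *
        (1 - activationProb gt u (Finset.univ \ T))) =
      (Measure.pi μ).real (rrSet u ⁻¹' {S}) := by
    simp only [key]
    exact moeb_sum (fun D => (Measure.pi μ).real (rrSet u ⁻¹' {D})) S
  rw [fin]
  exact ⟨measureReal_nonneg, measureReal_le_one⟩

end
end
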